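/- Let q = 3 (so λ = 1), α ∈ [√2 − 1, 1/2), l_1 = (2α−1)/(1−α) and r_1 = (1−2α)/α. Put A_0 = [α−1, −1/2) × [0, g²), A_1 = 𝒯_α(A_0), D_0 = [α, 1/2) × [0, g), D_1 = 𝒯_α(D_0), and Ω_α = ([α−1, l_1) × [0, g²)) ∪ ([l_1, r_1) × ([0, g²) ∪ [1/2, g))) ∪ ([r_1, α) × [0, g)). Then, up to a set of two-dimensional Lebesgue measure zero, (Ω_{1/2} ∪ A_0 ∪ A_1) \ (D_0 ∪ D_1) = Ω_α; moreover ∫∫_{Ω_α} (1 + xy)^{−2} dx dy = ∫∫_{Ω_{1/2}} (1 + xy)^{−2} dx dy. -/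

import Mathlib

open Real MeasureTheory Set
open scoped symmDiff

/-- The digit function `d_α(x) = ⌊|1/(λx)| + 1 − α⌋`. -/
noncomputable def rosenD (lam a x : ℝ) : ℤ := ⌊|1 / (lam * x)| + 1 - a⌋

/-- The α-Rosen map `T_α`. -/
noncomputable def rosenT (lam a : ℝ) (x : ℝ) : ℝ :=
  if x = 0 then 0 else |1 / x| - lam * rosenD lam a x

/-- The planar map `𝒯_α(x,y) = (T_α(x), 1/(d_α(x)λ + ε(x)·y))`. -/
noncomputable def rosenTT (lam a : ℝ) (z : ℝ × ℝ) : ℝ × ℝ :=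
  (rosenT lam a z.1, 1 / ((rosenD lam a z.1 : ℝ) * lam + Real.sign z.1 * z.2))

/-- The small golden number `g = (√5 − 1)/2`. -/
noncomputable def gold : ℝ := (Real.sqrt 5 - 1) / 2

/-- The NICF natural-extension domain `Ω_{1/2}` for `q = 3`. -/
noncomputable def Omega3 : Set (ℝ × ℝ) :=
  Set.Ico (-(1 : ℝ) / 2) 0 ×ˢ Set.Ico (0 : ℝ) (gold ^ 2) ∪
    Set.Ico (0 : ℝ) (1 / 2) ×ˢ Set.Ico (0 : ℝ) gold

/-- The region of changed digits `C`. -/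
noncomputable def changedDigits (lam a : ℝ) (Om : Set (ℝ × ℝ)) : Set (ℝ × ℝ) :=
  {z ∈ Om | z.1 ≠ 0 ∧ z.1 ∈ Set.Ico ((a - 1) * lam) (a * lam) ∧
    z.1 ∈ Set.Ico ((1 / 2 - 1) * lam) (1 / 2 * lam) ∧
    rosenD lam a z.1 ≠ rosenD lam (1 / 2) z.1}

theorem gold_sq : gold ^ 2 = 1 - gold := by
  have h : Real.sqrt 5 ^ 2 = 5 := Real.sq_sqrt (by norm_num)
  unfold gold
  linarith

theorem gold_lower : 3 / 5 < gold := by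
  have h : (11 / 5 : ℝ) < Real.sqrt 5 := Real.lt_sqrt_of_sq_lt (by norm_num)
  unfold gold
  linarith

theorem gold_upper : gold < 5 / 8 := by
  have h : Real.sqrt 5 < 9 / 4 := (Real.sqrt_lt' (by norm_num)).2 (by norm_num)
  unfold gold
  linarith

theorem one_add_mul_pos {a c d x y : ℝ} (ha : -1 < a) (hc : 0 ≤ c) (hd : d ≤ 1)
    (hx : a ≤ x) (hy : y ∈ Icc c d) : 0 < 1 + x * y := by
  have h0 : 0 ≤ y := hc.trans hy.1
  have h1 : y ≤ 1 := hy.2.trans hd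
  nlinarith [mul_nonneg (sub_nonneg.2 hx) h0, mul_nonneg h0 (by linarith : 0 ≤ a + 1)]

theorem continuousOn_density {a b c d : ℝ} (ha : -1 < a) (hc : 0 ≤ c) (hd : d ≤ 1) :
    ContinuousOn (fun z : ℝ × ℝ => ((1 + z.1 * z.2) ^ 2)⁻¹) (Icc a b ×ˢ Icc c d) := by
  refine ContinuousOn.inv₀ (by fun_prop) ?_
  rintro ⟨x, y⟩ ⟨hx, hy⟩
  exact pow_ne_zero 2 (one_add_mul_pos ha hc hd hx.1 hy).ne'

theorem integrableOn_density {a b c d : ℝ} (ha : -1 < a) (hc : 0 ≤ c) (hd : d ≤ 1) :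
    IntegrableOn (fun z : ℝ × ℝ => ((1 + z.1 * z.2) ^ 2)⁻¹) (Ico a b ×ˢ Ico c d) :=
  ((continuousOn_density ha hc hd).integrableOn_compact
    (isCompact_Icc.prod isCompact_Icc)).mono_set
      (prod_mono Ico_subset_Icc_self Ico_subset_Icc_self)

theorem integral_density_section {c d x : ℝ} (hx : -1 < x) (hc : 0 ≤ c) (hcd : c ≤ d)
    (hd : d ≤ 1) :
    ∫ y in Ico c d, ((1 + x * y) ^ 2)⁻¹ = d / (1 + x * d) - c / (1 + x * c) := by
  have hpos : ∀ y ∈ uIcc c d, 0 < 1 + x * y := fun y hy =>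
    one_add_mul_pos hx hc hd le_rfl (by rwa [uIcc_of_le hcd] at hy)
  rw [integral_Ico_eq_integral_Ioc, ← intervalIntegral.integral_of_le hcd]
  refine intervalIntegral.integral_eq_sub_of_hasDerivAt (f := fun y => y / (1 + x * y)) ?_ ?_
  · intro y hy
    have h := (hasDerivAt_id y).div (((hasDerivAt_id y).const_mul x).const_add 1) (hpos y hy).ne'
    refine h.congr_deriv ?_
    rw [inv_eq_one_div]
    congr 1
    simp only [id]
    ring
  · refine ContinuousOn.intervalIntegrable (ContinuousOn.inv₀ (by fun_prop) ?_)
    exact fun y hy => pow_ne_zero 2 (hpos y hy).ne'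

theorem integral_div_one_add_mul {a b t : ℝ} (ha : -1 < a) (hab : a ≤ b) (h0 : 0 ≤ t)
    (h1 : t ≤ 1) :
    IntervalIntegrable (fun x => t / (1 + x * t)) volume a b ∧
    ∫ x in a..b, t / (1 + x * t) = Real.log (1 + b * t) - Real.log (1 + a * t) := by
  have hpos : ∀ x ∈ uIcc a b, 0 < 1 + x * t := fun x hx =>
    one_add_mul_pos ha h0 h1 (by rw [uIcc_of_le hab] at hx; exact hx.1) ⟨le_rfl, le_rfl⟩
  have hi : IntervalIntegrable (fun x => t / (1 + x * t)) volume a b :=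
    ContinuousOn.intervalIntegrable
      (ContinuousOn.div (by fun_prop) (by fun_prop) fun x hx => (hpos x hx).ne')
  refine ⟨hi, intervalIntegral.integral_eq_sub_of_hasDerivAt
    (f := fun x => Real.log (1 + x * t)) ?_ hi⟩
  intro x hx
  have h := (((hasDerivAt_id x).mul_const t).const_add 1).log (hpos x hx).ne'
  simpa using h

/-- The mass of a rectangle under the density `(1 + xy)⁻²`. -/
theorem integral_density_rect {a b c d : ℝ} (ha : -1 < a) (hab : a ≤ b) (hc : 0 ≤ c)
    (hcd : c ≤ d) (hd : d ≤ 1) :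
    ∫ z in Ico a b ×ˢ Ico c d, ((1 + z.1 * z.2) ^ 2)⁻¹ =
      (Real.log (1 + b * d) - Real.log (1 + a * d)) -
        (Real.log (1 + b * c) - Real.log (1 + a * c)) := by
  obtain ⟨hi1, he1⟩ := integral_div_one_add_mul ha hab (hc.trans hcd) hd
  obtain ⟨hi2, he2⟩ := integral_div_one_add_mul ha hab hc (hcd.trans hd)
  have hint := integrableOn_density (b := b) ha hc hd
  rw [Measure.volume_eq_prod] at hint ⊢
  rw [setIntegral_prod _ hint, ← he1, ← he2, ← intervalIntegral.integral_sub hi1 hi2,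
    intervalIntegral.integral_of_le hab, ← integral_Ico_eq_integral_Ioc]
  refine setIntegral_congr_fun measurableSet_Ico fun x hx => ?_
  exact integral_density_section (ha.trans_le hx.1) hc hcd hd

theorem volume_prod_univ_of_finite {s : Set ℝ} (hs : s.Finite) :
    volume (s ×ˢ (univ : Set ℝ)) = 0 := by
  rw [Measure.volume_eq_prod, Measure.prod_prod, hs.measure_zero, zero_mul]

theorem volume_univ_prod_of_finite {s : Set ℝ} (hs : s.Finite) :
    volume ((univ : Set ℝ) ×ˢ s) = 0 := by
  rw [Measure.volume_eq_prod, Measure.prod_prod, hs.measure_zero, mul_zero]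

theorem rosenTT_of_neg {a x y : ℝ} (ha0 : 0 < a) (h1 : a - 1 ≤ x)
    (h2 : x < -1 / 2) : rosenTT 1 a (x, y) = (-1 / x - 2, 1 / (2 - y)) := by
  have hx : x < 0 := by linarith
  have habs : |1 / x| = -1 / x := by rw [abs_of_neg (one_div_neg.2 hx)]; ring
  have hinv : -1 / x = 1 / (-x) := by rw [div_neg, neg_div]
  have hd : rosenD 1 a x = 2 := by
    rw [rosenD, one_mul, habs, Int.floor_eq_iff, hinv]
    have h3 : 1 / (-x) < 2 := by rw [div_lt_iff₀ (by linarith)]; linarith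
    have h4 : 1 + a ≤ 1 / (-x) := by rw [le_div_iff₀ (by linarith)]; nlinarith
    push_cast
    constructor <;> linarith
  simp only [rosenTT, rosenT, if_neg hx.ne, hd, habs, Real.sign_of_neg hx]
  norm_num [sub_eq_add_neg]

theorem rosenTT_of_pos {a x y : ℝ} (ha0 : 0 < a) (hsq : 1 ≤ a ^ 2 + 2 * a)
    (h1 : a < x) (h2 : x < 1 / 2) : rosenTT 1 a (x, y) = (1 / x - 2, 1 / (2 + y)) := by
  have hx : 0 < x := by linarith
  have habs : |1 / x| = 1 / x := abs_of_pos (one_div_pos.2 hx)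
  have hd : rosenD 1 a x = 2 := by
    rw [rosenD, one_mul, habs, Int.floor_eq_iff]
    have h3 : 1 / x < 2 + a := by rw [div_lt_iff₀ hx]; nlinarith
    have h4 : 2 < 1 / x := by rw [lt_div_iff₀ hx]; linarith
    push_cast
    constructor <;> linarith
  simp only [rosenTT, rosenT, if_neg hx.ne', hd, habs, Real.sign_of_pos hx]
  norm_num

theorem image_rosenTT_left {a : ℝ} (ha : a < 1 / 2) (ha0 : 0 < a) :
    rosenTT 1 a '' (Ico (a - 1) (-(1 : ℝ) / 2) ×ˢ Ico (0 : ℝ) (gold ^ 2)) =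
      Ico ((2 * a - 1) / (1 - a)) 0 ×ˢ Ico (1 / 2 : ℝ) gold := by
  have hg := gold_sq
  have hl := gold_lower
  have hu := gold_upper
  have ha' : 0 < 1 - a := by linarith
  ext ⟨u, v⟩
  constructor
  · rintro ⟨⟨x, y⟩, ⟨⟨hx1, hx2⟩, hy1, hy2⟩, h⟩
    dsimp only at hx1 hx2 hy1 hy2
    rw [rosenTT_of_neg ha0 hx1 hx2, Prod.mk.injEq] at h
    obtain ⟨rfl, rfl⟩ := h
    have hx : 0 < -x := by linarith
    have hinv : -1 / x = 1 / (-x) := by rw [div_neg, neg_div]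
    rw [hinv]
    refine ⟨⟨?_, ?_⟩, ?_, ?_⟩ <;> dsimp only
    · rw [div_le_iff₀ ha']
      have : 1 ≤ 1 / (-x) * (1 - a) := by
        rw [one_div_mul_eq_div, le_div_iff₀ hx]; linarith
      linarith
    · have : 1 / (-x) < 2 := by rw [div_lt_iff₀ hx]; linarith
      linarith
    · rw [div_le_div_iff₀] <;> linarith
    · rw [div_lt_iff₀ (by linarith)]; nlinarith
  · rintro ⟨⟨hu1, hu2⟩, hv1, hv2⟩
    dsimp only at hu1 hu2 hv1 hv2
    rw [div_le_iff₀ ha'] at hu1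
    have hu0 : 0 < u + 2 := by nlinarith
    have hv0 : 0 < v := by linarith
    have hx1 : a - 1 ≤ -1 / (u + 2) := by rw [le_div_iff₀ hu0]; nlinarith
    have hx2 : -1 / (u + 2) < -1 / 2 := by rw [div_lt_div_iff₀ hu0 two_pos]; linarith
    refine ⟨(-1 / (u + 2), 2 - 1 / v), ⟨⟨hx1, hx2⟩, ?_, ?_⟩, ?_⟩
    · have : 1 / v ≤ 2 := by rw [div_le_iff₀ hv0]; linarith
      dsimp only
      linarith
    · have : 1 + gold < 1 / v := by rw [lt_div_iff₀ hv0]; nlinarith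
      dsimp only
      linarith
    · rw [rosenTT_of_neg ha0 hx1 hx2, Prod.mk.injEq]
      constructor
      · field_simp
        ring
      · simp

theorem image_rosenTT_right {a : ℝ} (ha0 : 0 < a) (hsq : 1 ≤ a ^ 2 + 2 * a) :
    rosenTT 1 a '' (Ioo a (1 / 2 : ℝ) ×ˢ Ico (0 : ℝ) gold) =
      Ioo 0 ((1 - 2 * a) / a) ×ˢ Ioc (gold ^ 2) (1 / 2 : ℝ) := by
  have hg := gold_sq
  have hl := gold_lower
  have hu := gold_upper
  ext ⟨u, v⟩
  constructor
  · rintro ⟨⟨x, y⟩, ⟨⟨hx1, hx2⟩, hy1, hy2⟩, h⟩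
    dsimp only at hx1 hx2 hy1 hy2
    rw [rosenTT_of_pos ha0 hsq hx1 hx2, Prod.mk.injEq] at h
    obtain ⟨rfl, rfl⟩ := h
    have hx : 0 < x := by linarith
    refine ⟨⟨?_, ?_⟩, ?_, ?_⟩ <;> dsimp only
    · have : 2 < 1 / x := by rw [lt_div_iff₀ hx]; linarith
      linarith
    · rw [lt_div_iff₀ ha0]
      have : 1 / x * a < 1 := by
        rw [one_div_mul_eq_div, div_lt_iff₀ hx]; linarith
      linarith
    · rw [lt_div_iff₀ (by linarith)]; nlinarith
    · rw [div_le_div_iff₀] <;> linarith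
  · rintro ⟨⟨hu1, hu2⟩, hv1, hv2⟩
    dsimp only at hu1 hu2 hv1 hv2
    rw [lt_div_iff₀ ha0] at hu2
    have hu0 : 0 < u + 2 := by linarith
    have hv0 : 0 < v := by linarith
    have hx1 : a < 1 / (u + 2) := by rw [lt_div_iff₀ hu0]; nlinarith
    have hx2 : 1 / (u + 2) < 1 / 2 := by rw [div_lt_div_iff₀ hu0 two_pos]; linarith
    refine ⟨(1 / (u + 2), 1 / v - 2), ⟨⟨hx1, hx2⟩, ?_, ?_⟩, ?_⟩
    · have : 2 ≤ 1 / v := by rw [le_div_iff₀ hv0]; linarith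
      dsimp only
      linarith
    · have : 1 / v < 2 + gold := by rw [div_lt_iff₀ hv0]; nlinarith
      dsimp only
      linarith
    · rw [rosenTT_of_pos ha0 hsq hx1 hx2]
      simp

theorem image_rosenTT_closed_right {a : ℝ} (ha0 : 0 < a) (hsq : 1 ≤ a ^ 2 + 2 * a) :
    ∃ t, rosenTT 1 a '' (Ico a (1 / 2 : ℝ) ×ˢ Ico (0 : ℝ) gold) ⊆
      Ioo 0 ((1 - 2 * a) / a) ×ˢ Ioc (gold ^ 2) (1 / 2 : ℝ) ∪ {t} ×ˢ univ ∧
      Ioo 0 ((1 - 2 * a) / a) ×ˢ Ioc (gold ^ 2) (1 / 2 : ℝ) ⊆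
        rosenTT 1 a '' (Ico a (1 / 2 : ℝ) ×ˢ Ico (0 : ℝ) gold) := by
  rw [← image_rosenTT_right ha0 hsq]
  refine ⟨rosenT 1 a a, ?_, image_mono (prod_mono Ioo_subset_Ico_self Subset.rfl)⟩
  rintro _ ⟨⟨x, y⟩, ⟨hx, hy⟩, rfl⟩
  rcases eq_or_lt_of_le hx.1 with h | h
  · right
    dsimp only at h
    subst h
    exact ⟨rfl, trivial⟩
  · exact Or.inl ⟨(x, y), ⟨⟨h, hx.2⟩, hy⟩, rfl⟩

theorem log_mass_identity {a : ℝ} (ha : a < 1 / 2) (ha0 : 0 < a) :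
    Real.log (1 + (1 - 2 * a) / a * gold ^ 2) - Real.log (1 + (a - 1) * gold ^ 2)
      - Real.log (1 + (2 * a - 1) / (1 - a) * gold)
      - Real.log (1 + (1 - 2 * a) / a * (1 / 2))
      + Real.log (1 + (2 * a - 1) / (1 - a) * (1 / 2)) + Real.log (1 + a * gold) =
    Real.log (1 + 1 / 2 * gold) - Real.log (1 + -1 / 2 * gold ^ 2) := by
  have hg := gold_sq
  have hl := gold_lower
  have ha' : 1 - a ≠ 0 := by linarith
  have hgn : gold ≠ 0 := by linarith
  have hP : 1 + a * gold ≠ 0 := by nlinarith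
  have e1 : 1 + (1 - 2 * a) / a * gold ^ 2 = gold ^ 2 * (1 + a * gold) / a := by
    field_simp
    linear_combination (-a * gold - a) * hg
  have e2 : 1 + (a - 1) * gold ^ 2 = gold * (1 + a * gold) := by
    linear_combination (-1) * hg
  have e3 : 1 + (2 * a - 1) / (1 - a) * gold = gold ^ 2 * (1 + a * gold) / (1 - a) := by
    field_simp
    linear_combination (-1 - a * gold + a) * hg
  have e4 : 1 + (1 - 2 * a) / a * (1 / 2) = 1 / (2 * a) := by
    field_simp
    ring
  have e5 : 1 + (2 * a - 1) / (1 - a) * (1 / 2) = 1 / (2 * (1 - a)) := by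
    field_simp
    ring
  have e6 : 1 + 1 / 2 * gold = 1 / (2 * gold ^ 2) := by
    field_simp
    linear_combination (gold + 1) * hg
  have e7 : 1 + -1 / 2 * gold ^ 2 = 1 / (2 * gold) := by
    field_simp
    linear_combination (1 - gold) * hg
  rw [e1, e2, e3, e4, e5, e6, e7,
    Real.log_div (by positivity) ha0.ne', Real.log_div (by positivity) ha',
    Real.log_mul (pow_ne_zero 2 hgn) hP, Real.log_mul hgn hP,
    Real.log_div one_ne_zero (by positivity), Real.log_div one_ne_zero (by positivity),
    Real.log_div one_ne_zero (by positivity), Real.log_div one_ne_zero (by positivity),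
    Real.log_mul two_ne_zero ha0.ne', Real.log_mul two_ne_zero ha',
    Real.log_mul two_ne_zero (pow_ne_zero 2 hgn), Real.log_mul two_ne_zero hgn, Real.log_pow]
  push_cast
  ring

/-- for `q = 3` (so `λ = 1`), `α ∈ [√2 − 1, 1/2)`, the quilted region equals
`Ω_α` up to Lebesgue measure zero, and the `μ`-areas of `Ω_α` and `Ω_{1/2}` agree. -/
theorem stmt18 (lam : ℝ) (hlam : lam = 2 * Real.cos (Real.pi / 3))
    (a : ℝ) (ha0 : Real.sqrt 2 - 1 ≤ a) (ha1 : a < 1 / 2)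
    (l1 r1 : ℝ) (hl1 : l1 = (2 * a - 1) / (1 - a)) (hr1 : r1 = (1 - 2 * a) / a)
    (A0 D0 A1 D1 OmA : Set (ℝ × ℝ))
    (hA0 : A0 = Set.Ico (a - 1) (-(1 : ℝ) / 2) ×ˢ Set.Ico (0 : ℝ) (gold ^ 2))
    (hD0 : D0 = Set.Ico a (1 / 2 : ℝ) ×ˢ Set.Ico (0 : ℝ) gold)
    (hA1 : A1 = rosenTT lam a '' A0) (hD1 : D1 = rosenTT lam a '' D0)
    (hOmA : OmA =
      Set.Ico (a - 1) l1 ×ˢ Set.Ico (0 : ℝ) (gold ^ 2) ∪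
        Set.Ico l1 r1 ×ˢ (Set.Ico (0 : ℝ) (gold ^ 2) ∪ Set.Ico (1 / 2 : ℝ) gold) ∪
        Set.Ico r1 a ×ˢ Set.Ico (0 : ℝ) gold) :
    volume (((Omega3 ∪ A0 ∪ A1) \ (D0 ∪ D1)) ∆ OmA) = 0 ∧
    ∫ z in OmA, ((1 + z.1 * z.2) ^ 2)⁻¹ = ∫ z in Omega3, ((1 + z.1 * z.2) ^ 2)⁻¹ := by
  have hlam1 : lam = 1 := by rw [hlam, Real.cos_pi_div_three]; norm_num
  have hs2 : Real.sqrt 2 ^ 2 = 2 := Real.sq_sqrt zero_le_two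
  have hs1 : 1 < Real.sqrt 2 := Real.lt_sqrt_of_sq_lt (by norm_num)
  have hapos : 0 < a := by linarith
  have hsq : 1 ≤ a ^ 2 + 2 * a := by nlinarith
  have hg := gold_sq
  have hl := gold_lower
  have hu := gold_upper
  have hr0 : 0 < r1 := by rw [hr1]; exact div_pos (by linarith) hapos
  have hra : r1 ≤ a := by rw [hr1, div_le_iff₀ hapos]; nlinarith
  have hl0 : l1 < 0 := by rw [hl1]; exact div_neg_of_neg_of_pos (by linarith) (by linarith)
  have hla : a - 1 ≤ l1 := by rw [hl1, le_div_iff₀ (by linarith)]; nlinarith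
  have hA1' : A1 = Ico l1 0 ×ˢ Ico (1 / 2 : ℝ) gold := by
    rw [hA1, hA0, hlam1, image_rosenTT_left ha1 hapos, hl1]
  obtain ⟨t, ht1, ht2⟩ := image_rosenTT_closed_right hapos hsq
  rw [hlam1] at hD1
  rw [← hD0, ← hD1, ← hr1] at ht1 ht2
  constructor
  · refine measure_mono_null (t := ({t, 0, r1} ×ˢ univ) ∪ (univ ×ˢ {gold ^ 2, 1 / 2})) ?_
      (measure_union_null (volume_prod_univ_of_finite (Set.toFinite _))
        (volume_univ_prod_of_finite (Set.toFinite _)))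
    rintro ⟨x, y⟩ h
    by_contra hN
    have hD1' : (x, y) ∈ D1 ↔ (0 < x ∧ x < r1) ∧ gold ^ 2 < y ∧ y ≤ 1 / 2 := by
      constructor
      · intro hz
        rcases ht1 hz with hz | hz
        · exact hz
        · exact absurd (Or.inl ⟨Or.inl hz.1, trivial⟩) hN
      · exact fun hz => ht2 hz
    simp only [mem_union, mem_prod, mem_insert_iff, mem_singleton_iff, mem_univ, and_true,
      true_and, not_or] at hN
    obtain ⟨⟨-, hx0, hxr⟩, hyg, hyh⟩ := hN
    simp only [mem_symmDiff, mem_sdiff, mem_union, hD1', hA1', hA0, hD0, hOmA, Omega3, mem_prod,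
      mem_Ico] at h
    grind
  · have hm1 : Disjoint (Ico l1 r1 ×ˢ Ico (0 : ℝ) (gold ^ 2))
        (Ico l1 r1 ×ˢ Ico (1 / 2 : ℝ) gold) :=
      disjoint_left.2 fun z h1 h2 => by linarith [h1.2.2, h2.2.1]
    have hm2 : Disjoint (Ico (a - 1) l1 ×ˢ Ico (0 : ℝ) (gold ^ 2))
        (Ico l1 r1 ×ˢ Ico (0 : ℝ) (gold ^ 2) ∪ Ico l1 r1 ×ˢ Ico (1 / 2 : ℝ) gold) :=
      disjoint_left.2 fun z h1 h2 => by
        rcases h2 with h2 | h2 <;> linarith [h1.1.2, h2.1.1]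
    have hm3 : Disjoint (Ico (a - 1) l1 ×ˢ Ico (0 : ℝ) (gold ^ 2) ∪
        (Ico l1 r1 ×ˢ Ico (0 : ℝ) (gold ^ 2) ∪ Ico l1 r1 ×ˢ Ico (1 / 2 : ℝ) gold))
        (Ico r1 a ×ˢ Ico (0 : ℝ) gold) :=
      disjoint_left.2 fun z h1 h2 => by
        rcases h1 with h1 | h1 | h1 <;> linarith [h1.1.2, h2.1.1]
    have hm4 : Disjoint (Ico (-(1 : ℝ) / 2) 0 ×ˢ Ico (0 : ℝ) (gold ^ 2))
        (Ico (0 : ℝ) (1 / 2) ×ˢ Ico (0 : ℝ) gold) :=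
      disjoint_left.2 fun z h1 h2 => by linarith [h1.1.2, h2.1.1]
    have hms : ∀ p q r s : ℝ, MeasurableSet (Ico p q ×ˢ Ico r s) := fun p q r s =>
      measurableSet_Ico.prod measurableSet_Ico
    have i1 := integrableOn_density (a := a - 1) (b := l1) (c := 0) (d := gold ^ 2)
      (by linarith) le_rfl (by linarith)
    have i2 := integrableOn_density (a := l1) (b := r1) (c := 0) (d := gold ^ 2)
      (by linarith) le_rfl (by linarith)
    have i3 := integrableOn_density (a := l1) (b := r1) (c := 1 / 2) (d := gold)
      (by linarith) (by norm_num) (by linarith)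
    have i4 := integrableOn_density (a := r1) (b := a) (c := 0) (d := gold)
      (by linarith) le_rfl (by linarith)
    have i5 := integrableOn_density (a := -(1 : ℝ) / 2) (b := 0) (c := 0) (d := gold ^ 2)
      (by norm_num) le_rfl (by linarith)
    have i6 := integrableOn_density (a := 0) (b := 1 / 2) (c := 0) (d := gold)
      (by norm_num) le_rfl (by linarith)
    have key := log_mass_identity ha1 hapos
    rw [← hl1, ← hr1] at key
    rw [hOmA, Omega3, prod_union, setIntegral_union hm3 (hms _ _ _ _) (i1.union (i2.union i3)) i4,
      setIntegral_union hm2 ((hms _ _ _ _).union (hms _ _ _ _)) i1 (i2.union i3),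
      setIntegral_union hm1 (hms _ _ _ _) i2 i3, setIntegral_union hm4 (hms _ _ _ _) i5 i6,
      integral_density_rect, integral_density_rect, integral_density_rect, integral_density_rect,
      integral_density_rect, integral_density_rect]
    · simp only [mul_zero, zero_mul, add_zero, Real.log_one, sub_zero]
      linarith
    all_goals linarith
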